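/- Let p be a prime and k, n ≥ 1, s ≥ 0 integers with k = (p^(s+1) − 1)/(p − 1). Let A(p^k, n) be the incidence matrix of points and hyperplanes in (ℤ/p^kℤ)^n: rows indexed by pairs (b, λ) where b ∈ (ℤ/p^kℤ)^n has at least one unit coordinate (up to unit scaling) and λ ∈ ℤ/p^kℤ, columns indexed by (ℤ/p^kℤ)^n, with entry 1 iff ⟨b,y⟩ = λ and 0 otherwise. Assuming there exists a Kakeya set S ⊆ (ℤ/p^kℤ)^n of size at most p^(kn)/k^(n−1) · (1 − 1/p)^(−n), the 𝔽_p-rank of A(p^k, n) is at most p^(kn)/k^(n−1) · (1 − 1/p)^(−n). -/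

import Mathlib

open scoped Classical

theorem exists_rows {K m n : Type*} [Field K] [Fintype m] [Fintype n] (A : Matrix m n K)
    (r : ℕ) (hr : A.rank = r) :
    ∃ f : Fin r → m, LinearIndependent K (A.submatrix f id).row := by
  subst hr
  rw [Matrix.rank_eq_finrank_span_row]
  obtain ⟨f, h1, -, h3⟩ := Submodule.exists_fun_fin_finrank_span_eq K (Set.range A.row)
  choose g hg using h1
  refine ⟨g, ?_⟩
  have : (A.submatrix g id).row = f := by
    funext i; rw [← hg]; rfl
  rw [this]; exact h3

theorem exists_minor {K m n : Type*} [Field K] [Fintype m] [Fintype n] (A : Matrix m n K) :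
    ∃ (f : Fin A.rank → m) (g : Fin A.rank → n), (A.submatrix f g).det ≠ 0 := by
  obtain ⟨f, hf⟩ := exists_rows A _ rfl
  have h1 := hf.rank_matrix
  rw [Fintype.card_fin] at h1
  obtain ⟨g, hg⟩ := exists_rows (A.submatrix f id).transpose A.rank
    (by rw [Matrix.rank_transpose, h1])
  refine ⟨f, g, ?_⟩
  rw [Matrix.linearIndependent_rows_iff_isUnit, Matrix.isUnit_iff_isUnit_det] at hg
  rw [← Matrix.det_transpose]
  exact hg.ne_zero

theorem rank_le_of_cyclotomic (p k : ℕ) [hp : Fact p.Prime] (hk : 1 ≤ k) (ζ : ℂ)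
    (hζ : IsPrimitiveRoot ζ (p ^ k)) {m n : Type*} [Fintype m] [Fintype n]
    (M : Matrix m n (Polynomial ℤ)) (A : Matrix m n (ZMod p))
    (hA : ∀ i j, A i j = (((M i j).eval 1 : ℤ) : ZMod p)) (d : ℕ)
    (hd : (M.map (Polynomial.aeval ζ)).rank ≤ d) : A.rank ≤ d := by
  obtain ⟨f, g, hfg⟩ := exists_minor A
  by_contra hlt
  push Not at hlt
  apply hfg
  have h0 : Polynomial.aeval ζ (M.submatrix f g).det = 0 := by
    rw [AlgHom.map_det]
    by_contra hne
    have h1 := Matrix.rank_of_det_ne_zero hne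
    have h2 := Matrix.rank_submatrix_le (M.map (Polynomial.aeval ζ)) f g
    simp only [Fintype.card_fin] at h1
    have h3 : (AlgHom.mapMatrix (Polynomial.aeval ζ : Polynomial ℤ →ₐ[ℤ] ℂ)) (M.submatrix f g) =
      (M.map (Polynomial.aeval ζ)).submatrix f g := rfl
    rw [h3] at h1
    omega
  have hpos : 0 < p ^ k := pow_pos hp.out.pos k
  have h4 := minpoly.isIntegrallyClosed_dvd (hζ.isIntegral hpos) h0
  rw [← Polynomial.cyclotomic_eq_minpoly hζ hpos] at h4
  obtain ⟨q, hq⟩ := h4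
  have h5 : (A.submatrix f g) = ((Int.castRingHom (ZMod p)).comp
      (Polynomial.evalRingHom 1)).mapMatrix (M.submatrix f g) := by
    ext i j; simp [hA]
  obtain ⟨k, rfl⟩ : ∃ k', k = k' + 1 := ⟨k - 1, by omega⟩
  rw [h5, ← RingHom.map_det, hq]
  simp [Polynomial.eval_one_cyclotomic_prime_pow]

theorem kakeya_rank (p k n : ℕ) [hp : Fact p.Prime] (hk : 1 ≤ k)
    (S : Finset (Fin n → ZMod (p ^ k)))
    (hS : ∀ b : Fin n → ZMod (p ^ k), (∃ i, IsUnit (b i)) →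
        ∃ u, ∀ t : ZMod (p ^ k), u + t • b ∈ S)
    (A : Matrix ({b : Fin n → ZMod (p ^ k) // ∃ i, IsUnit (b i)} × ZMod (p ^ k))
      (Fin n → ZMod (p ^ k)) (ZMod p))
    (hA : ∀ r y, A r y =
      if ∑ i, (r.1 : Fin n → ZMod (p ^ k)) i * y i = r.2 then 1 else 0) :
    A.rank ≤ S.card := by
  have hN : p ^ k ≠ 0 := pow_ne_zero _ hp.out.ne_zero
  have : NeZero (p ^ k) := ⟨hN⟩
  have hζ := Complex.isPrimitiveRoot_exp (p ^ k) hN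
  set ζ := Complex.exp (2 * Real.pi * Complex.I / (p ^ k : ℕ)) with hζd
  clear_value ζ
  have hψ := AddChar.zmodChar_primitive_of_primitive_root (p ^ k) hζ
  have hψv : ∀ a, AddChar.zmodChar (p ^ k) hζ.pow_eq_one a = ζ ^ a.val :=
    AddChar.zmodChar_apply _
  set ψ := AddChar.zmodChar (p ^ k) hζ.pow_eq_one with hψd
  replace hψ : ψ.IsPrimitive := hψ
  clear_value ψ
  choose u hu using hS
  let M : Matrix ({b : Fin n → ZMod (p ^ k) // ∃ i, IsUnit (b i)} × ZMod (p ^ k))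
      (Fin n → ZMod (p ^ k)) (Polynomial ℤ) := fun r y =>
    if ∑ i, (r.1 : Fin n → ZMod (p ^ k)) i * y i = r.2 then
      Polynomial.X ^ (∑ i, u r.1.1 r.1.2 i * y i).val else 0
  refine rank_le_of_cyclotomic p k hk ζ hζ M A ?_ _ ?_
  · intro i j
    rw [hA]
    simp only [M]
    split_ifs <;> simp
  let B : Matrix ({b : Fin n → ZMod (p ^ k) // ∃ i, IsUnit (b i)} × ZMod (p ^ k)) S ℂ :=
    fun r x => ∑ t : ZMod (p ^ k),
      if x = (⟨u r.1.1 r.1.2 + t • r.1.1, hu _ _ t⟩ : S) then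
        ((p ^ k : ℕ) : ℂ)⁻¹ * ψ (-(t * r.2)) else 0
  let C : Matrix S (Fin n → ZMod (p ^ k)) ℂ := fun x y => ψ (∑ i, x.1 i * y i)
  have hBC : M.map (Polynomial.aeval ζ) = B * C := by
    ext r y
    have h1 : (B * C) r y = ∑ t : ZMod (p ^ k), ((p ^ k : ℕ) : ℂ)⁻¹ *
        ψ (∑ i, u r.1.1 r.1.2 i * y i) * ψ (t * (∑ i, r.1.1 i * y i - r.2)) := by
      rw [Matrix.mul_apply]
      simp only [B, C, Finset.sum_mul]
      rw [Finset.sum_comm]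
      refine Finset.sum_congr rfl fun t _ => ?_
      simp only [ite_mul, zero_mul, Finset.sum_ite_eq', Finset.sum_ite_eq, Finset.mem_univ, if_true]
      rw [mul_assoc, mul_assoc, ← AddChar.map_add_eq_mul, ← AddChar.map_add_eq_mul]
      congr 2
      simp only [Pi.add_apply, Pi.smul_apply, smul_eq_mul, add_mul, Finset.sum_add_distrib,
        mul_assoc, ← Finset.mul_sum]
      ring
    rw [h1, ← Finset.mul_sum, AddChar.sum_mulShift _ hψ]
    have hN' : ((p ^ k : ℕ) : ℂ) ≠ 0 := by exact_mod_cast hN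
    rw [Matrix.map_apply]
    simp only [M, sub_eq_zero, ZMod.card]
    split_ifs
    · rw [hψv, map_pow, Polynomial.aeval_X, mul_right_comm, inv_mul_cancel₀ hN', one_mul]
    · simp
  rw [hBC]
  refine (Matrix.rank_mul_le_left B C).trans ((Matrix.rank_le_card_width B).trans ?_)
  simp

theorem stmt6 (p k n s : ℕ) [hp : Fact p.Prime] (hk : 1 ≤ k) (hn : 1 ≤ n)
    (hks : k * (p - 1) = p ^ (s + 1) - 1)
    (hKakeya : ∃ S : Finset (Fin n → ZMod (p ^ k)),
      (∀ b : Fin n → ZMod (p ^ k), (∃ i, IsUnit (b i)) →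
        ∃ u, ∀ t : ZMod (p ^ k), u + t • b ∈ S) ∧
      (S.card : ℝ) ≤ (p : ℝ) ^ (k * n) / (k : ℝ) ^ (n - 1) * ((1 - 1 / (p : ℝ)) ^ n)⁻¹)
    (A : Matrix ({b : Fin n → ZMod (p ^ k) // ∃ i, IsUnit (b i)} × ZMod (p ^ k))
      (Fin n → ZMod (p ^ k)) (ZMod p))
    (hA : ∀ r y, A r y =
      if ∑ i, (r.1 : Fin n → ZMod (p ^ k)) i * y i = r.2 then 1 else 0) :
    (A.rank : ℝ) ≤ (p : ℝ) ^ (k * n) / (k : ℝ) ^ (n - 1) * ((1 - 1 / (p : ℝ)) ^ n)⁻¹ := by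
  obtain ⟨S, hS, hc⟩ := hKakeya
  have h : (A.rank : ℝ) ≤ S.card := by
    exact_mod_cast kakeya_rank p k n hk S hS A hA
  exact h.trans hc
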